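/- The map α from the space of frequency measures to the space of geodesic currents determined by α(μ)(Cyl[x,y]) = μ(Cyl(x⁻¹y)) for all x, y ∈ F is well defined and bijective, is a homeomorphism with respect to the weak-* topologies (where measures m_i converge to m if ∫φ dm_i → ∫φ dm for every compactly supported continuous function φ), and satisfies L(α(μ)) = ||μ|| for every frequency measure μ. -/

import Mathlib

open MeasureTheory Filter Topology
open scoped ENNReal NNReal

namespace FGC

noncomputable section

variable (k : ℕ)

/-- The alphabet `A = Σ ∪ Σ⁻¹`: a letter is a basis element together with a sign. -/
abbrev L := Fin k × Bool

/-- The inverse of a letter. -/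
def linv (a : L k) : L k := (a.1, !a.2)

/-- A right-infinite word is (freely) reduced if no letter is followed by its inverse. -/
def Red (x : ℕ → L k) : Prop := ∀ n, x (n + 1) ≠ linv k (x n)

/-- The boundary `∂F`: the set of infinite freely reduced words in the alphabet `A`. -/
def Boundary : Type := { x : ℕ → L k // Red k x }

instance : TopologicalSpace (Boundary k) :=
  inferInstanceAs (TopologicalSpace { x : ℕ → L k // Red k x })

instance : MeasurableSpace (Boundary k) := borel _

instance : BorelSpace (Boundary k) := ⟨rfl⟩

/-- The free group of rank `k`. -/
abbrev F := FreeGroup (Fin k)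

/-- The word length `|v|` of an element of `F`. -/
def wordLength (v : F k) : ℕ := v.toWord.length

/-- The cyclically reduced length `‖v‖`: the minimal word length among conjugates of `v`. -/
def cyclLength (v : F k) : ℕ := sInf { n | ∃ g : F k, wordLength k (g * v * g⁻¹) = n }

/-- The cylinder `Cyl v ⊆ ∂F` of rays starting with the reduced word of `v`. -/
def Cyl (v : F k) : Set (Boundary k) :=
  { x | ∀ i : Fin v.toWord.length, x.1 i = v.toWord.get i }

/-- The shift deleting the first letter of a ray. -/
def shift (x : ℕ → L k) : ℕ → L k := fun n => x (n + 1)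

/-- Prepending a letter to a ray. -/
def cons (a : L k) (x : ℕ → L k) : ℕ → L k
  | 0 => a
  | n + 1 => x n

/-- Prepending a (reversed) finite word to a ray, performing free reduction. -/
def prependAux : List (L k) → (ℕ → L k) → ℕ → L k
  | [], x => x
  | a :: r, x => prependAux r (if x 0 = linv k a then shift k x else cons k a x)

theorem red_shift {x : ℕ → L k} (hx : Red k x) : Red k (shift k x) :=
  fun n => hx (n + 1)

theorem red_cons {a : L k} {x : ℕ → L k} (hx : Red k x) (h : x 0 ≠ linv k a) :
    Red k (cons k a x) := by
  intro n
  cases n with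
  | zero => exact h
  | succ m => exact hx m

theorem red_prependAux : ∀ (r : List (L k)) {x : ℕ → L k}, Red k x → Red k (prependAux k r x)
  | [], _, hx => hx
  | a :: r, x, hx => by
    by_cases h : x 0 = linv k a
    · simp only [prependAux, if_pos h]
      exact red_prependAux r (red_shift k hx)
    · simp only [prependAux, if_neg h]
      exact red_prependAux r (red_cons k hx h)

/-- The left-translation action of `F` on `∂F`: concatenate and freely reduce. -/
def act (g : F k) (x : Boundary k) : Boundary k :=
  ⟨prependAux k g.toWord.reverse x.1, red_prependAux k _ x.2⟩

/-- The shift map `T : ∂F → ∂F`. -/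
def Tmap (x : Boundary k) : Boundary k := ⟨shift k x.1, red_shift k x.2⟩

/-- The double boundary `∂²F`, as the complement of the diagonal. -/
def D2 : Set (Boundary k × Boundary k) := { p | p.1 ≠ p.2 }

/-- The diagonal action of `F` on `∂F × ∂F`. -/
def actPair (g : F k) (p : Boundary k × Boundary k) : Boundary k × Boundary k :=
  (act k g p.1, act k g p.2)

/-- The cylinder `Cyl[1,w]` of geodesics through the segment from `1` to `w`. -/
def baseCyl (w : F k) : Set (Boundary k × Boundary k) :=
  { p | p.1.1 0 ≠ p.2.1 0 ∧ p.2 ∈ Cyl k w }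

/-- The base-ball `B = Cyl[1,1]` of geodesics through the base point. -/
def baseBall : Set (Boundary k × Boundary k) := baseCyl k 1

/-- The cylinder `Cyl[x,y] = x · Cyl[1, x⁻¹y]`. -/
def Cyl2 (x y : F k) : Set (Boundary k × Boundary k) :=
  actPair k x '' baseCyl k (x⁻¹ * y)

/-- A geodesic current: a Borel measure on `∂F × ∂F` giving no mass to the diagonal,
invariant under the diagonal `F`-action, and finite on compact subsets of `∂²F`. -/
def IsCurrent (η : Measure (Boundary k × Boundary k)) : Prop :=
  η { p | p.1 = p.2 } = 0 ∧
  (∀ g : F k, ∀ W : Set (Boundary k × Boundary k), MeasurableSet W →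
    η (actPair k g ⁻¹' W) = η W) ∧
  (∀ K : Set (Boundary k × Boundary k), K ⊆ D2 k → IsCompact K → η K < ⊤)

/-- The element of `F` given by the first `n` letters of a ray. -/
def prefixEl (x : Boundary k) (n : ℕ) : F k :=
  FreeGroup.mk (List.ofFn fun i : Fin n => x.1 i)

/-- `b : ∂F → ∂F` is the boundary extension of the automorphism `Φ`: for every ray `x`
and every `m`, the length-`m` prefix of `b x` is the length-`m` prefix of the reduced
word of `Φ (x|_n)` for all sufficiently large `n`. -/
def IsBdryExt (Φ : F k ≃* F k) (b : Boundary k → Boundary k) : Prop :=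
  ∀ x : Boundary k, ∀ m : ℕ, ∃ N : ℕ, ∀ n ≥ N,
    (Φ (prefixEl k x n)).toWord.take m = List.ofFn fun i : Fin m => (b x).1 i

/-- The map `∂Φ × ∂Φ` on pairs. -/
def pairMap (b : Boundary k → Boundary k) (p : Boundary k × Boundary k) :
    Boundary k × Boundary k := (b p.1, b p.2)

/-- The length of an automorphism with boundary map `b`, w.r.t. the current `η`:
`L(Φ) = η((∂Φ × ∂Φ)⁻¹ B)`. -/
def autLen (η : Measure (Boundary k × Boundary k)) (b : Boundary k → Boundary k) : ℝ≥0∞ :=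
  η (pairMap k b ⁻¹' baseBall k)

/-- The subgroup of inner automorphisms. -/
abbrev Inn : Subgroup (MulAut (F k)) := (MulAut.conj : F k →* MulAut (F k)).range

/-- `Out(F) = Aut(F)/Inn(F)` as a coset space. -/
abbrev OutQ := MulAut (F k) ⧸ Inn k

/-- A simple automorphism: induced by a permutation of the basis, or inner. -/
def SimpleAut (Φ : MulAut (F k)) : Prop :=
  (∃ σ : Equiv.Perm (Fin k), ∀ i, Φ (FreeGroup.of i) = FreeGroup.of (σ i)) ∨
  (∃ v : F k, ∀ x, Φ x = v * x * v⁻¹)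

/-- A Whitehead automorphism of the second kind. -/
def Whitehead2 (τ : MulAut (F k)) : Prop :=
  ∃ a : Fin k, ∀ i : Fin k,
    τ (FreeGroup.of i) = FreeGroup.of i ∨
    τ (FreeGroup.of i) = FreeGroup.of i * FreeGroup.of a ∨
    τ (FreeGroup.of i) = (FreeGroup.of a)⁻¹ * FreeGroup.of i ∨
    τ (FreeGroup.of i) = (FreeGroup.of a)⁻¹ * FreeGroup.of i * FreeGroup.of a

/-- The space of frequency measures: finite `T`-invariant Borel measures on `∂F`. -/
def FreqM : Type :=
  { μ : Measure (Boundary k) //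
    IsFiniteMeasure μ ∧ ∀ W : Set (Boundary k), MeasurableSet W → μ (Tmap k ⁻¹' W) = μ W }

/-- The space of geodesic currents. -/
def Currents : Type := { η : Measure (Boundary k × Boundary k) // IsCurrent k η }

/-- Continuous functions on `∂F × ∂F` with compact support contained in `∂²F`;
these are the test functions for the weak-* topology on currents. -/
def TestF : Type :=
  { φ : Boundary k × Boundary k → ℝ //
    Continuous φ ∧ IsCompact (tsupport φ) ∧ tsupport φ ⊆ D2 k }

/-- The weak-* topology on frequency measures. -/
instance : TopologicalSpace (FreqM k) :=
  ⨅ φ : C(Boundary k, ℝ),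
    TopologicalSpace.induced (fun μ : FreqM k => ∫ x, φ x ∂μ.1) inferInstance

/-- The weak-* topology on geodesic currents. -/
instance : TopologicalSpace (Currents k) :=
  ⨅ φ : TestF k,
    TopologicalSpace.induced (fun η : Currents k => ∫ p, φ.1 p ∂η.1) inferInstance

/-- Convergence of a sequence of group elements (as reduced words) to a boundary ray. -/
def WordTendsto (pn : ℕ → F k) (p : Boundary k) : Prop :=
  ∀ m : ℕ, ∃ N : ℕ, ∀ n ≥ N, (pn n).toWord.take m = List.ofFn fun i : Fin m => p.1 i

/-- The length of the maximal common initial segment of two rays. -/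
def commonLen (p : Boundary k × Boundary k) : ℕ :=
  sSup { m : ℕ | ∀ i < m, p.1.1 i = p.2.1 i }

/-- A single letter as an element of `F`. -/
def el (a : L k) : F k := FreeGroup.mk [a]

/-- The product of per-letter constants over the reduced word of `w`. -/
def Cprod (C : L k → ℝ≥0) (w : F k) : ℝ≥0 := (w.toWord.map C).prod

variable {k}

section Topology

instance : T2Space (Boundary k) := inferInstanceAs (T2Space { x : ℕ → L k // Red k x })

theorem isEmbedding_val : IsEmbedding (fun x : Boundary k => x.1) := IsEmbedding.subtypeVal

instance : SecondCountableTopology (Boundary k) :=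
  isEmbedding_val.secondCountableTopology

instance : TopologicalSpace.MetrizableSpace (Boundary k) :=
  isEmbedding_val.metrizableSpace

theorem isClosed_setOf_red : IsClosed { x : ℕ → L k | Red k x } := by
  simp only [Red, Set.ofPred_forall]
  refine isClosed_iInter fun n => ?_
  have hc : Continuous fun x : ℕ → L k => (x (n + 1), x n) := by fun_prop
  exact (isClosed_discrete { z : L k × L k | z.1 ≠ linv k z.2 }).preimage hc

instance : CompactSpace (Boundary k) :=
  isCompact_iff_compactSpace.mp (isClosed_setOf_red (k := k)).isCompact

theorem continuous_coord (n : ℕ) : Continuous fun x : Boundary k => x.1 n :=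
  (continuous_apply n).comp continuous_subtype_val

theorem continuous_Tmap : Continuous (Tmap k) :=
  Continuous.subtype_mk (continuous_pi fun n => continuous_coord (n + 1)) _

theorem isClopen_baseBall : IsClopen (baseBall k) := by
  have hc : Continuous fun p : Boundary k × Boundary k => (p.1.1 0, p.2.1 0) :=
    ((continuous_coord 0).comp continuous_fst).prodMk ((continuous_coord 0).comp continuous_snd)
  have : baseBall k = (fun p : Boundary k × Boundary k => (p.1.1 0, p.2.1 0)) ⁻¹'
      { z | z.1 ≠ z.2 } := by
    ext p
    simp [baseBall, baseCyl, Cyl]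
  rw [this]
  exact (isClopen_discrete _).preimage hc

end Topology

theorem mem_baseBall {p : Boundary k × Boundary k} : p ∈ baseBall k ↔ p.1.1 0 ≠ p.2.1 0 := by
  simp [baseBall, baseCyl, Cyl]

theorem baseBall_subset_D2 : baseBall k ⊆ D2 k := fun p hp h =>
  mem_baseBall.1 hp (by rw [h])

section Action

@[simp] theorem linv_linv (a : L k) : linv k (linv k a) = a := by simp [linv]

theorem linv_ne (a : L k) : linv k a ≠ a := fun h => by simpa [linv] using congrArg Prod.snd h

/-- Left translation of a ray by a single letter. -/
def letterAct (a : L k) (x : Boundary k) : Boundary k :=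
  ⟨if x.1 0 = linv k a then shift k x.1 else cons k a x.1, by
    split_ifs with h
    · exact red_shift k x.2
    · exact red_cons k x.2 h⟩

theorem letterAct_of_eq {a : L k} {x : Boundary k} (h : x.1 0 = linv k a) :
    letterAct a x = Tmap k x := Subtype.ext (if_pos h)

theorem letterAct_val_of_ne {a : L k} {x : Boundary k} (h : x.1 0 ≠ linv k a) :
    (letterAct a x).1 = cons k a x.1 := if_neg h

theorem letterAct_zero_of_ne {a : L k} {x : Boundary k} (h : x.1 0 ≠ linv k a) :
    (letterAct a x).1 0 = a := by
  rw [letterAct_val_of_ne h, cons]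

theorem letterAct_zero_ne {a : L k} {x : Boundary k} (h : x.1 0 = linv k a) :
    (letterAct a x).1 0 ≠ a := by
  rw [letterAct_of_eq h]
  have := x.2 0
  rwa [h, linv_linv] at this

theorem letterAct_linv (a : L k) (x : Boundary k) : letterAct (linv k a) (letterAct a x) = x := by
  by_cases h : x.1 0 = linv k a
  · have h' : (letterAct a x).1 0 ≠ linv k (linv k a) := by
      rw [linv_linv]
      exact letterAct_zero_ne h
    apply Subtype.ext
    rw [letterAct_val_of_ne h', letterAct_of_eq h]
    funext n
    cases n with
    | zero => exact h.symm
    | succ n => rfl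
  · rw [letterAct_of_eq (by rw [linv_linv]; exact letterAct_zero_of_ne h)]
    apply Subtype.ext
    simp only [Tmap, letterAct_val_of_ne h]
    rfl

theorem letterAct_linv' (a : L k) (x : Boundary k) :
    letterAct a (letterAct (linv k a) x) = x := by
  simpa using letterAct_linv (linv k a) x

theorem continuous_letterAct (a : L k) : Continuous (letterAct a) := by
  refine Continuous.subtype_mk (continuous_pi fun n => ?_) _
  have hc : Continuous fun x : Boundary k => (x.1 0, x.1 (n + 1), x.1 (n - 1)) :=
    (continuous_coord 0).prodMk ((continuous_coord (n + 1)).prodMk (continuous_coord (n - 1)))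
  have hd : Continuous fun z : L k × L k × L k =>
      if z.1 = linv k a then z.2.1 else if n = 0 then a else z.2.2 :=
    continuous_of_discreteTopology
  convert hd.comp hc using 1
  funext x
  rcases n with _ | n <;> by_cases h : x.1 0 = linv k a <;> simp [h, shift, cons]

/-- Left translation by a letter as a permutation of the boundary. -/
def letterPerm (a : L k) : Equiv.Perm (Boundary k) where
  toFun := letterAct a
  invFun := letterAct (linv k a)
  left_inv := letterAct_linv a
  right_inv := letterAct_linv' a

/-- The action of `F` on its boundary as a homomorphism to the permutation group. -/
def boundaryPerm : F k →* Equiv.Perm (Boundary k) :=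
  FreeGroup.lift fun i => letterPerm (i, true)

theorem boundaryPerm_mk (l : List (L k)) :
    boundaryPerm (FreeGroup.mk l) = (l.map letterPerm).prod := by
  rw [boundaryPerm, FreeGroup.lift_mk]
  congr 2
  funext a
  rcases a with ⟨i, _ | _⟩ <;> rfl

theorem boundaryPerm_mk_cons (a : L k) (l : List (L k)) (x : Boundary k) :
    boundaryPerm (FreeGroup.mk (a :: l)) x = letterAct a (boundaryPerm (FreeGroup.mk l) x) := by
  rw [boundaryPerm_mk, boundaryPerm_mk, List.map_cons, List.prod_cons]
  rfl

theorem prependAux_append (l l' : List (L k)) (x : ℕ → L k) :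
    prependAux k (l ++ l') x = prependAux k l' (prependAux k l x) := by
  induction l generalizing x with
  | nil => rfl
  | cons a l ih => exact ih _

theorem prependAux_reverse (l : List (L k)) (x : Boundary k) :
    prependAux k l.reverse x.1 = (boundaryPerm (FreeGroup.mk l) x).1 := by
  induction l with
  | nil => rfl
  | cons a l ih =>
    rw [List.reverse_cons, prependAux_append, ih, boundaryPerm_mk_cons]
    rfl

theorem act_eq (g : F k) (x : Boundary k) : act k g x = boundaryPerm g x := by
  apply Subtype.ext
  have h := prependAux_reverse g.toWord x
  rwa [FreeGroup.mk_toWord] at h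

theorem act_one (x : Boundary k) : act k 1 x = x := by simp [act_eq]

theorem act_mul (g h : F k) (x : Boundary k) : act k (g * h) x = act k g (act k h x) := by
  simp [act_eq]

theorem act_el (a : L k) (x : Boundary k) : act k (el k a) x = letterAct a x := by
  rw [act_eq, el, boundaryPerm_mk_cons, ← FreeGroup.one_eq_mk, map_one]
  rfl

theorem el_linv (a : L k) : el k (linv k a) = (el k a)⁻¹ := by
  simp [el, linv, FreeGroup.invRev]

theorem continuous_act (g : F k) : Continuous (act k g) := by
  have key : ∀ l : List (L k), Continuous fun x => boundaryPerm (FreeGroup.mk l) x := by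
    intro l
    induction l with
    | nil => exact continuous_id
    | cons a l ih =>
      simp only [boundaryPerm_mk_cons]
      exact (continuous_letterAct a).comp ih
  have : act k g = fun x => boundaryPerm (FreeGroup.mk g.toWord) x := by
    funext x
    rw [act_eq, FreeGroup.mk_toWord]
  rw [this]
  exact key _

theorem actPair_one (p : Boundary k × Boundary k) : actPair k 1 p = p := by
  simp [actPair, act_one]

theorem actPair_mul (g h : F k) (p : Boundary k × Boundary k) :
    actPair k (g * h) p = actPair k g (actPair k h p) := by
  simp [actPair, act_mul]

@[simp] theorem actPair_inv_actPair (g : F k) (p : Boundary k × Boundary k) :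
    actPair k g⁻¹ (actPair k g p) = p := by
  rw [← actPair_mul, inv_mul_cancel, actPair_one]

@[simp] theorem actPair_actPair_inv (g : F k) (p : Boundary k × Boundary k) :
    actPair k g (actPair k g⁻¹ p) = p := by
  rw [← actPair_mul, mul_inv_cancel, actPair_one]

theorem preimage_actPair_mul (g h : F k) (W : Set (Boundary k × Boundary k)) :
    actPair k (g * h) ⁻¹' W = actPair k h ⁻¹' (actPair k g ⁻¹' W) := by
  ext p
  simp [actPair_mul]

theorem continuous_actPair (g : F k) : Continuous (actPair k g) :=
  ((continuous_act g).comp continuous_fst).prodMk ((continuous_act g).comp continuous_snd)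

theorem measurable_actPair (g : F k) : Measurable (actPair k g) :=
  (continuous_actPair g).measurable

theorem actPair_mem_D2 {g : F k} {p : Boundary k × Boundary k} :
    actPair k g p ∈ D2 k ↔ p ∈ D2 k := by
  simp [D2, actPair, act_eq]

/-- A reduced word ending in `a` translates all rays not starting with `a⁻¹` to rays with one
and the same first letter. -/
theorem act_mk_append_zero (l : List (L k)) (a : L k) (hl : FreeGroup.IsReduced (l ++ [a]))
    {x : Boundary k} (hx : x.1 0 ≠ linv k a) :
    (act k (FreeGroup.mk (l ++ [a])) x).1 0 = (l ++ [a]).head (by simp) := by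
  induction l with
  | nil => exact (congrArg (fun y => y.1 0) (act_el a x)).trans (letterAct_zero_of_ne hx)
  | cons b l ih =>
    have hl' : FreeGroup.IsReduced (l ++ [a]) := List.IsChain.right_of_append (l₁ := [b]) hl
    have h := ih hl'
    rw [act_eq] at h
    simp only [List.cons_append, act_eq, boundaryPerm_mk_cons, List.head_cons]
    apply letterAct_zero_of_ne
    rw [h]
    cases l with
    | nil =>
      simp only [List.cons_append, List.nil_append, FreeGroup.isReduced_cons_cons] at hl
      intro h'
      simp only [List.nil_append, List.head_cons] at h'
      subst h'
      simpa [linv] using hl.1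
    | cons c l =>
      simp only [List.cons_append, FreeGroup.isReduced_cons_cons] at hl
      intro h'
      simp only [List.cons_append, List.head_cons] at h'
      subst h'
      simpa [linv] using hl.1

/-- If a geodesic and its translate by a reduced word `l ++ [a]` both pass through the base
point, then so does its translate by the last letter `a`. -/
theorem actPair_el_mem_baseBall {l : List (L k)} {a : L k}
    (hl : FreeGroup.IsReduced (l ++ [a])) {p : Boundary k × Boundary k} (hp : p ∈ baseBall k)
    (hgp : actPair k (FreeGroup.mk (l ++ [a])) p ∈ baseBall k) :
    actPair k (el k a) p ∈ baseBall k := by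
  rw [mem_baseBall] at *
  simp only [actPair, act_el] at *
  by_cases h1 : p.1.1 0 = linv k a
  · rw [letterAct_zero_of_ne (x := p.2) (fun h => hp (h1.trans h.symm))]
    exact letterAct_zero_ne h1
  · by_cases h2 : p.2.1 0 = linv k a
    · rw [letterAct_zero_of_ne (x := p.1) h1]
      exact (letterAct_zero_ne h2).symm
    · exact absurd ((act_mk_append_zero l a hl h1).trans (act_mk_append_zero l a hl h2).symm) hgp

end Action

section Flow

/-- The shift of pointed geodesics: move the base point one step towards the second end. -/
def geodShift (p : Boundary k × Boundary k) : Boundary k × Boundary k :=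
  actPair k (el k (linv k (p.2.1 0))) p

theorem continuous_geodShift : Continuous (geodShift (k := k)) := by
  have h : Continuous fun z : L k × (Boundary k × Boundary k) =>
      actPair k (el k (linv k z.1)) z.2 :=
    continuous_prod_of_discrete_left.2 fun a => continuous_actPair (el k (linv k a))
  exact h.comp (((continuous_coord 0).comp continuous_snd).prodMk continuous_id)

theorem geodShift_fst {p : Boundary k × Boundary k} (hp : p ∈ baseBall k) :
    (geodShift p).1.1 = cons k (linv k (p.2.1 0)) p.1.1 := by
  rw [mem_baseBall] at hp
  simp only [geodShift, actPair, act_el]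
  exact letterAct_val_of_ne (by simpa using hp)

theorem geodShift_snd (p : Boundary k × Boundary k) : (geodShift p).2 = Tmap k p.2 := by
  simp only [geodShift, actPair, act_el]
  exact letterAct_of_eq (by simp)

theorem geodShift_mem_baseBall {p : Boundary k × Boundary k} (hp : p ∈ baseBall k) :
    geodShift p ∈ baseBall k := by
  rw [mem_baseBall, geodShift_fst hp, geodShift_snd]
  exact (p.2.2 0).symm

theorem iterate_geodShift_snd (n : ℕ) (p : Boundary k × Boundary k) :
    (geodShift^[n] p).2 = (Tmap k)^[n] p.2 := by
  induction n with
  | zero => rfl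
  | succ n ih => rw [Function.iterate_succ_apply', Function.iterate_succ_apply', geodShift_snd, ih]

theorem iterate_geodShift_mem_baseBall (n : ℕ) {p : Boundary k × Boundary k}
    (hp : p ∈ baseBall k) : geodShift^[n] p ∈ baseBall k := by
  induction n with
  | zero => exact hp
  | succ n ih =>
    rw [Function.iterate_succ_apply']
    exact geodShift_mem_baseBall ih

theorem iterate_geodShift_fst_eq (n : ℕ) {p p' : Boundary k × Boundary k} (hp : p ∈ baseBall k)
    (hp' : p' ∈ baseBall k) (h : p.2 = p'.2) :
    ∀ i < n, (geodShift^[n] p).1.1 i = (geodShift^[n] p').1.1 i := by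
  induction n with
  | zero => simp
  | succ n ih =>
    intro i hi
    rw [Function.iterate_succ_apply', Function.iterate_succ_apply',
      geodShift_fst (iterate_geodShift_mem_baseBall n hp),
      geodShift_fst (iterate_geodShift_mem_baseBall n hp'), iterate_geodShift_snd,
      iterate_geodShift_snd, h]
    cases i with
    | zero => rfl
    | succ i => exact ih i (by omega)

/-- A finite shift-invariant measure on the space of geodesics through the base point. -/
structure IsFlowMeasure (ν : Measure (Boundary k × Boundary k)) : Prop where
  finite : IsFiniteMeasure ν
  conull : ν (baseBall k)ᶜ = 0
  invariant : MeasurePreserving geodShift ν ν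

theorem measurableSet_baseBall : MeasurableSet (baseBall k) :=
  isClopen_baseBall.isOpen.measurableSet

theorem measurableSet_D2 : MeasurableSet (D2 k) :=
  (isOpen_ne_fun continuous_fst continuous_snd).measurableSet

theorem IsFlowMeasure.measure_preimage_el_of_fst {ν : Measure (Boundary k × Boundary k)}
    (hν : IsFlowMeasure ν) {a : L k} {V : Set (Boundary k × Boundary k)} (hV : MeasurableSet V)
    (hVB : V ⊆ baseBall k) (ha : ∀ p ∈ V, p.1.1 0 = a) :
    ν (actPair k (el k a) ⁻¹' V) = ν V := by
  rw [← hν.invariant.measure_preimage hV.nullMeasurableSet,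
    ← measure_inter_conull hν.conull, ← measure_inter_conull (s := geodShift ⁻¹' V) hν.conull]
  congr 1
  ext p
  simp only [Set.mem_inter_iff, Set.mem_preimage, and_congr_left_iff]
  intro hp
  have hp' := mem_baseBall.1 hp
  have key : p.2.1 0 = linv k a → geodShift p = actPair k (el k a) p := by
    intro h
    rw [geodShift, h, linv_linv]
  constructor
  · intro h
    have h1 : (letterAct a p.1).1 0 = a := act_el a p.1 ▸ ha _ h
    have h2 : (letterAct a p.1).1 0 ≠ (letterAct a p.2).1 0 := by
      rw [← act_el, ← act_el]
      exact mem_baseBall.1 (hVB h)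
    have h3 : p.2.1 0 = linv k a := by
      by_contra h3
      exact h2 (h1.trans (letterAct_zero_of_ne h3).symm)
    rwa [key h3]
  · intro h
    have h1 := ha _ h
    rw [geodShift_fst hp, cons] at h1
    rwa [← key (by rw [← h1, linv_linv])]

theorem IsFlowMeasure.measure_preimage_el {ν : Measure (Boundary k × Boundary k)}
    (hν : IsFlowMeasure ν) {a : L k} {V : Set (Boundary k × Boundary k)} (hV : MeasurableSet V)
    (hVB : V ⊆ baseBall k) (hVB' : actPair k (el k a) ⁻¹' V ⊆ baseBall k) :
    ν (actPair k (el k a) ⁻¹' V) = ν V := by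
  have hm : MeasurableSet {p : Boundary k × Boundary k | p.1.1 0 = a} :=
    (((continuous_coord 0).comp continuous_fst).measurable (measurableSet_singleton a))
  set E := {p : Boundary k × Boundary k | p.1.1 0 = a}
  rw [← measure_inter_add_sdiff V hm,
    ← measure_inter_add_sdiff (actPair k (el k a) ⁻¹' V) (measurable_actPair (el k a) hm),
    ← Set.preimage_inter, ← Set.preimage_sdiff]
  congr 1
  · exact hν.measure_preimage_el_of_fst (hV.inter hm) (Set.inter_subset_left.trans hVB)
      fun p hp => hp.2
  · have h1 : actPair k (el k (linv k a)) ⁻¹' (actPair k (el k a) ⁻¹' (V \ E)) = V \ E := by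
      ext p
      simp [el_linv]
    conv_rhs => rw [← h1]
    refine (hν.measure_preimage_el_of_fst (measurable_actPair _ (hV.diff hm))
      ((Set.preimage_mono Set.sdiff_subset).trans hVB') fun p hp => ?_).symm
    by_contra h
    refine hp.2 ?_
    simp only [E, actPair, act_el, Set.mem_ofPred_eq]
    exact letterAct_zero_of_ne h

/-- A flow measure is invariant under all partial translations between geodesics through the
base point. -/
theorem IsFlowMeasure.measure_preimage_actPair {ν : Measure (Boundary k × Boundary k)}
    (hν : IsFlowMeasure ν) (g : F k) {V : Set (Boundary k × Boundary k)} (hV : MeasurableSet V)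
    (hVB : V ⊆ baseBall k) (hVB' : actPair k g ⁻¹' V ⊆ baseBall k) :
    ν (actPair k g ⁻¹' V) = ν V := by
  have key : ∀ l : List (L k), FreeGroup.IsReduced l → ∀ V : Set (Boundary k × Boundary k),
      MeasurableSet V → V ⊆ baseBall k → actPair k (FreeGroup.mk l) ⁻¹' V ⊆ baseBall k →
      ν (actPair k (FreeGroup.mk l) ⁻¹' V) = ν V := by
    intro l
    induction l using List.reverseRecOn with
    | nil =>
      intro _ V _ _ _
      rfl
    | append_singleton l a ih =>
      intro hl V hV hVB hVB'
      have hmul : FreeGroup.mk (l ++ [a]) = FreeGroup.mk l * el k a := by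
        rw [el, FreeGroup.mul_mk]
      have hsub : actPair k (FreeGroup.mk l) ⁻¹' V ⊆ baseBall k := by
        intro p hp
        have h1 : actPair k (el k a) (actPair k (el k a)⁻¹ p) = p := actPair_actPair_inv _ _
        have h2 : actPair k (FreeGroup.mk (l ++ [a])) (actPair k (el k a)⁻¹ p) ∈ V := by
          rwa [hmul, actPair_mul, h1]
        rw [← h1]
        exact actPair_el_mem_baseBall hl (hVB' h2) (hVB h2)
      rw [hmul, preimage_actPair_mul] at hVB' ⊢
      rw [hν.measure_preimage_el (measurable_actPair _ hV) hsub hVB',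
        ih (List.IsChain.left_of_append hl) V hV hVB hsub]
  rw [← FreeGroup.mk_toWord (x := g)] at hVB' ⊢
  exact key _ FreeGroup.isReduced_toWord V hV hVB hVB'

end Flow

section Pieces

/-- An enumeration of the free group. -/
def enumF (k : ℕ) : ℕ → F k := (exists_surjective_nat (F k)).choose

theorem enumF_surjective : Function.Surjective (enumF k) :=
  (exists_surjective_nat (F k)).choose_spec

/-- The translate `g · B` of the base-ball. -/
def ball (g : F k) : Set (Boundary k × Boundary k) := actPair k g⁻¹ ⁻¹' baseBall k

/-- A partition of `∂²F` into countably many clopen pieces, each contained in a ball. -/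
def piece (k : ℕ) : ℕ → Set (Boundary k × Boundary k) := disjointed fun n => ball (enumF k n)

theorem isClopen_ball (g : F k) : IsClopen (ball g) :=
  isClopen_baseBall.preimage (continuous_actPair _)

theorem isClopen_piece (n : ℕ) : IsClopen (piece k n) :=
  disjointedRec (p := IsClopen) (fun _ _ h => h.diff (isClopen_ball _)) (isClopen_ball _)

theorem measurableSet_piece (n : ℕ) : MeasurableSet (piece k n) :=
  (isClopen_piece n).isOpen.measurableSet

theorem piece_subset (n : ℕ) : piece k n ⊆ ball (enumF k n) := disjointed_subset _ n

theorem disjoint_piece : Pairwise (Function.onFun Disjoint (piece k)) := disjoint_disjointed _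

theorem ball_subset_D2 (g : F k) : ball g ⊆ D2 k := fun _ hp =>
  actPair_mem_D2.1 (baseBall_subset_D2 hp)

theorem exists_mem_ball {p : Boundary k × Boundary k} (hp : p ∈ D2 k) : ∃ g, p ∈ ball g := by
  have key : ∀ n : ℕ, ∀ p : Boundary k × Boundary k, p.1.1 n ≠ p.2.1 n → ∃ g, p ∈ ball g := by
    intro n
    induction n with
    | zero =>
      intro p hp
      exact ⟨1, by simpa [ball, actPair_one, mem_baseBall] using hp⟩
    | succ n ih =>
      intro p hp
      by_cases h : p.1.1 0 = p.2.1 0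
      · obtain ⟨g, hg⟩ := ih (Tmap k p.1, Tmap k p.2) hp
        refine ⟨el k (p.1.1 0) * g, ?_⟩
        have h1 : actPair k (el k (p.1.1 0))⁻¹ p = (Tmap k p.1, Tmap k p.2) := by
          rw [← el_linv]
          simp only [actPair, act_el]
          rw [letterAct_of_eq (by simp), letterAct_of_eq (by simp [h])]
        rw [ball, Set.mem_preimage, mul_inv_rev, actPair_mul, h1]
        exact hg
      · exact ⟨1, by simpa [ball, actPair_one, mem_baseBall] using h⟩
  have : ∃ n, p.1.1 n ≠ p.2.1 n := by
    by_contra h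
    push Not at h
    exact hp (Subtype.ext (funext h))
  obtain ⟨n, hn⟩ := this
  exact key n p hn

theorem iUnion_piece : ⋃ n, piece k n = D2 k := by
  rw [piece, iUnion_disjointed]
  ext p
  simp only [Set.mem_iUnion]
  constructor
  · rintro ⟨n, hn⟩
    exact ball_subset_D2 _ hn
  · intro hp
    obtain ⟨g, hg⟩ := exists_mem_ball hp
    obtain ⟨n, rfl⟩ := enumF_surjective g
    exact ⟨n, hg⟩

theorem measure_eq_tsum_pieces {m : Measure (Boundary k × Boundary k)} (hm : m (D2 k)ᶜ = 0)
    {W : Set (Boundary k × Boundary k)} (hW : MeasurableSet W) :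
    m W = ∑' n, m (piece k n ∩ W) := by
  rw [← measure_inter_conull hm, ← iUnion_piece, Set.inter_comm, Set.iUnion_inter,
    measure_iUnion]
  · exact fun i j hij => (disjoint_piece hij).mono Set.inter_subset_left Set.inter_subset_left
  · exact fun n => (measurableSet_piece n).inter hW

/-- A compact subset of `∂²F` meets only finitely many pieces. -/
theorem exists_subset_biUnion_piece {K : Set (Boundary k × Boundary k)} (hK : IsCompact K)
    (hKD : K ⊆ D2 k) : ∃ t : Finset ℕ, K ⊆ ⋃ n ∈ t, piece k n :=
  hK.elim_finite_subcover _ (fun n => (isClopen_piece n).isOpen) (iUnion_piece (k := k) ▸ hKD)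

end Pieces

section Currents

theorem subset_ball_iff {g : F k} {W : Set (Boundary k × Boundary k)} :
    W ⊆ ball g ↔ actPair k g ⁻¹' W ⊆ baseBall k := by
  constructor
  · intro h p hp
    simpa [ball] using h hp
  · intro h p hp
    exact h (by simpa using hp)

/-- The extension of a flow measure to `∂²F`. -/
def currentOf (ν : Measure (Boundary k × Boundary k)) : Measure (Boundary k × Boundary k) :=
  Measure.sum fun n => (ν.map (actPair k (enumF k n))).restrict (piece k n)

theorem currentOf_apply (ν : Measure (Boundary k × Boundary k))
    {W : Set (Boundary k × Boundary k)} (hW : MeasurableSet W) :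
    currentOf ν W = ∑' n, ν (actPair k (enumF k n) ⁻¹' (piece k n ∩ W)) := by
  rw [currentOf, Measure.sum_apply _ hW]
  congr 1
  funext n
  rw [Measure.restrict_apply hW, Measure.map_apply (measurable_actPair _)
    (hW.inter (measurableSet_piece n)), Set.inter_comm]

theorem currentOf_compl_D2 (ν : Measure (Boundary k × Boundary k)) :
    currentOf ν (D2 k)ᶜ = 0 := by
  rw [currentOf_apply ν measurableSet_D2.compl, ENNReal.tsum_eq_zero]
  intro n
  have : piece k n ∩ (D2 k)ᶜ = ∅ := by
    rw [← Set.sdiff_eq, Set.sdiff_eq_empty]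
    exact (piece_subset n).trans (ball_subset_D2 _)
  simp [this]

theorem IsFlowMeasure.currentOf_apply_of_subset_ball {ν : Measure (Boundary k × Boundary k)}
    (hν : IsFlowMeasure ν) {h : F k} {W : Set (Boundary k × Boundary k)} (hW : MeasurableSet W)
    (hWB : W ⊆ ball h) : currentOf ν W = ν (actPair k h ⁻¹' W) := by
  have hmem : ∀ n, MeasurableSet (piece k n ∩ W) := fun n => (measurableSet_piece n).inter hW
  have hpart : W = ⋃ n, piece k n ∩ W := by
    rw [← Set.iUnion_inter, iUnion_piece, eq_comm, Set.inter_eq_right]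
    exact hWB.trans (ball_subset_D2 h)
  conv_rhs => rw [hpart, Set.preimage_iUnion]
  rw [currentOf_apply ν hW, measure_iUnion]
  · congr 1
    funext n
    have hV := subset_ball_iff.1 (Set.inter_subset_left.trans (piece_subset n) :
      piece k n ∩ W ⊆ ball (enumF k n))
    have hV' := subset_ball_iff.1 (Set.inter_subset_right.trans hWB : piece k n ∩ W ⊆ ball h)
    have heq : actPair k ((enumF k n)⁻¹ * h) ⁻¹' (actPair k (enumF k n) ⁻¹' (piece k n ∩ W)) =
        actPair k h ⁻¹' (piece k n ∩ W) := by
      rw [← preimage_actPair_mul, mul_inv_cancel_left]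
    rw [← hν.measure_preimage_actPair ((enumF k n)⁻¹ * h) (measurable_actPair _ (hmem n)) hV
      (by rwa [heq]), heq]
  · exact fun i j hij => ((disjoint_piece hij).mono Set.inter_subset_left
      Set.inter_subset_left).preimage _
  · exact fun n => measurable_actPair _ (hmem n)

theorem IsFlowMeasure.currentOf_ball_lt_top {ν : Measure (Boundary k × Boundary k)}
    (hν : IsFlowMeasure ν) (g : F k) : currentOf ν (ball g) < ⊤ := by
  have := hν.finite
  rw [hν.currentOf_apply_of_subset_ball (isClopen_ball g).isOpen.measurableSet subset_rfl]
  exact measure_lt_top ν _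

theorem IsFlowMeasure.currentOf_piece_lt_top {ν : Measure (Boundary k × Boundary k)}
    (hν : IsFlowMeasure ν) (n : ℕ) : currentOf ν (piece k n) < ⊤ :=
  (measure_mono (piece_subset n)).trans_lt (hν.currentOf_ball_lt_top _)

theorem IsFlowMeasure.isCurrent_currentOf {ν : Measure (Boundary k × Boundary k)}
    (hν : IsFlowMeasure ν) : IsCurrent k (currentOf ν) := by
  have hD : { p : Boundary k × Boundary k | p.1 = p.2 } = (D2 k)ᶜ := by
    ext p
    simp [D2]
  refine ⟨hD ▸ currentOf_compl_D2 ν, fun g W hW => ?_, fun K hKD hK => ?_⟩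
  · have hD' : actPair k g ⁻¹' D2 k = D2 k := by
      ext p
      exact actPair_mem_D2
    have h0 := currentOf_compl_D2 ν
    rw [measure_eq_tsum_pieces h0 hW, ← measure_inter_conull h0]
    nth_rewrite 1 [← hD']
    rw [← Set.preimage_inter, ← iUnion_piece, Set.inter_iUnion, Set.preimage_iUnion,
      measure_iUnion]
    · congr 1
      funext n
      have h1 : piece k n ∩ W ⊆ ball (enumF k n) :=
        Set.inter_subset_left.trans (piece_subset n)
      have hm : MeasurableSet (piece k n ∩ W) := (measurableSet_piece n).inter hW
      have h2 : actPair k (g⁻¹ * enumF k n) ⁻¹' (actPair k g ⁻¹' (piece k n ∩ W)) =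
          actPair k (enumF k n) ⁻¹' (piece k n ∩ W) := by
        rw [← preimage_actPair_mul, mul_inv_cancel_left]
      rw [Set.inter_comm, hν.currentOf_apply_of_subset_ball hm h1,
        hν.currentOf_apply_of_subset_ball (h := g⁻¹ * enumF k n) (measurable_actPair g hm)
        (by rw [subset_ball_iff, h2]; exact subset_ball_iff.1 h1), h2]
    · exact fun i j hij => ((disjoint_piece hij).mono Set.inter_subset_right
        Set.inter_subset_right).preimage _
    · exact fun n => measurable_actPair g (hW.inter (measurableSet_piece n))
  · obtain ⟨t, ht⟩ := exists_subset_biUnion_piece hK hKD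
    exact (measure_mono ht).trans_lt
      ((measure_biUnion_finset_le t _).trans_lt
        (ENNReal.sum_lt_top.2 fun n _ => hν.currentOf_piece_lt_top n))

end Currents

section Extension

theorem exists_forall_agree_lt (ψ : C(Boundary k × Boundary k, ℝ)) {ε : ℝ} (hε : 0 < ε) :
    ∃ N : ℕ, ∀ p p' : Boundary k × Boundary k, p.2 = p'.2 → (∀ i < N, p.1.1 i = p'.1.1 i) →
      |ψ p - ψ p'| < ε := by
  let V : ℕ → Set ((Boundary k × Boundary k) × (Boundary k × Boundary k)) := fun N =>
    { z | z.1.2 = z.2.2 } ∩ ⋂ i, ⋂ (_ : i < N), { z | z.1.1.1 i = z.2.1.1 i }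
  have hanti : Antitone V := fun m n hmn z hz =>
    ⟨hz.1, by
      have := hz.2
      simp only [Set.mem_iInter] at this ⊢
      exact fun i hi => this i (hi.trans_le hmn)⟩
  have hclosed : ∀ N, IsClosed (V N) := fun N =>
    (isClosed_eq (continuous_snd.comp continuous_fst) (continuous_snd.comp continuous_snd)).inter
      (isClosed_iInter fun i => isClosed_iInter fun _ =>
        isClosed_eq ((continuous_coord i).comp (continuous_fst.comp continuous_fst))
          ((continuous_coord i).comp (continuous_fst.comp continuous_snd)))
  have hU : IsOpen { z : (Boundary k × Boundary k) × (Boundary k × Boundary k) |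
      |ψ z.1 - ψ z.2| < ε } :=
    isOpen_lt (by fun_prop) continuous_const
  obtain ⟨N, hN⟩ := exists_subset_nhds_of_compactSpace hanti.directed_ge hclosed
    (U := { z | |ψ z.1 - ψ z.2| < ε }) fun z hz => by
      refine hU.mem_nhds ?_
      simp only [V, Set.mem_iInter, Set.mem_inter_iff] at hz
      have h1 : z.1 = z.2 :=
        Prod.ext (Subtype.ext (funext fun i => (hz (i + 1)).2 i (Nat.lt_succ_self i))) (hz 0).1
      simp [h1, hε]
  refine ⟨N, fun p p' h h' => hN (show (p, p') ∈ V N from ⟨h, ?_⟩)⟩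
  simpa only [Set.mem_iInter, Set.mem_ofPred_eq] using h'

/-- Along the shift, a continuous function asymptotically depends on the second end only. -/
theorem exists_forall_iterate_geodShift_le (ψ : C(Boundary k × Boundary k, ℝ)) {ε : ℝ}
    (hε : 0 < ε) :
    ∃ N : ℕ, ∀ n ≥ N, ∀ p ∈ baseBall k, ∀ p' ∈ baseBall k, p.2 = p'.2 →
      |ψ (geodShift^[n] p) - ψ (geodShift^[n] p')| ≤ ε := by
  obtain ⟨N, hN⟩ := exists_forall_agree_lt ψ hε
  refine ⟨N, fun n hn p hp p' hp' h => (hN _ _ ?_ fun i hi => ?_).le⟩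
  · rw [iterate_geodShift_snd, iterate_geodShift_snd, h]
  · exact iterate_geodShift_fst_eq n hp hp' h i (hi.trans_le hn)

/-- A geodesic through the base point with a prescribed second end. -/
def seed (x : Boundary k) : Boundary k × Boundary k :=
  (⟨fun _ => linv k (x.1 0), fun _ => (linv_ne _).symm⟩, x)

theorem seed_mem_baseBall (x : Boundary k) : seed x ∈ baseBall k :=
  mem_baseBall.2 (linv_ne _)

theorem continuous_seed : Continuous (seed (k := k)) :=
  (Continuous.subtype_mk (continuous_pi fun _ =>
    (continuous_of_discreteTopology (f := linv k)).comp (continuous_coord 0)) _).prodMk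
    continuous_id

theorem continuous_iterate_seed (n : ℕ) : Continuous fun x : Boundary k => geodShift^[n] (seed x) :=
  (continuous_geodShift.iterate n).comp continuous_seed

theorem integrable_of_continuous {X : Type*} [TopologicalSpace X] [CompactSpace X]
    [MeasurableSpace X] [OpensMeasurableSpace X] {m : Measure X} [IsFiniteMeasure m] {f : X → ℝ}
    (hf : Continuous f) : Integrable f m :=
  hf.integrable_of_hasCompactSupport (HasCompactSupport.of_compactSpace f)

theorem continuous_indicator {X : Type*} [TopologicalSpace X] {s : Set X} {f : X → ℝ}
    (hs : IsClopen s) (hf : Continuous f) : Continuous (s.indicator f) :=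
  hf.indicator (by simp [hs.frontier_eq])

theorem abs_integral_iterate_sub_le {ψ : C(Boundary k × Boundary k, ℝ)} {ε : ℝ} {n : ℕ}
    (hn : ∀ p ∈ baseBall k, ∀ p' ∈ baseBall k, p.2 = p'.2 →
      |ψ (geodShift^[n] p) - ψ (geodShift^[n] p')| ≤ ε)
    {m : Measure (Boundary k × Boundary k)} [IsFiniteMeasure m] (hm : m (baseBall k)ᶜ = 0)
    {μ : Measure (Boundary k)} (hμ : m.map Prod.snd = μ) :
    |∫ p, ψ (geodShift^[n] p) ∂m - ∫ x, ψ (geodShift^[n] (seed x)) ∂μ| ≤ ε * μ.real Set.univ := by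
  have hc1 : Continuous fun p => ψ (geodShift^[n] p) :=
    ψ.continuous.comp (continuous_geodShift.iterate n)
  have hc2 : Continuous fun x => ψ (geodShift^[n] (seed x)) :=
    ψ.continuous.comp (continuous_iterate_seed n)
  have hc2' : Continuous fun p : Boundary k × Boundary k => ψ (geodShift^[n] (seed p.2)) :=
    hc2.comp continuous_snd
  have hmass : μ.real Set.univ = m.real Set.univ := by
    rw [← hμ, map_measureReal_apply measurable_snd MeasurableSet.univ, Set.preimage_univ]
  rw [hmass, ← hμ, integral_map measurable_snd.aemeasurable hc2.aestronglyMeasurable,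
    ← integral_sub (integrable_of_continuous hc1) (integrable_of_continuous hc2')]
  rw [← Real.norm_eq_abs]
  refine norm_integral_le_of_norm_le_const (μ := m) ?_
  have : ∀ᵐ p ∂m, p ∈ baseBall k := by
    rw [ae_iff]
    exact hm
  filter_upwards [this] with p hp
  exact hn p hp _ (seed_mem_baseBall _) rfl

theorem exists_pos_mul_lt (c : ℝ) {ε : ℝ} (hε : 0 < ε) (hc : 0 ≤ c) :
    ∃ δ > 0, ∀ c' ≤ c + 1, δ * c' < ε := by
  refine ⟨ε / (c + 2), by positivity, fun c' hc' => ?_⟩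
  rw [div_mul_eq_mul_div, div_lt_iff₀ (by positivity)]
  exact mul_lt_mul_of_pos_left (by linarith) hε

theorem IsFlowMeasure.integral_iterate {ν : Measure (Boundary k × Boundary k)}
    (hν : IsFlowMeasure ν) (ψ : C(Boundary k × Boundary k, ℝ)) (n : ℕ) :
    ∫ p, ψ (geodShift^[n] p) ∂ν = ∫ p, ψ p ∂ν := by
  have hp := hν.invariant.iterate n
  conv_rhs => rw [← hp.map_eq]
  rw [integral_map hp.measurable.aemeasurable ψ.continuous.aestronglyMeasurable]

/-- A flow measure is the limit of the images of its marginal under the shifted seeds. -/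
theorem IsFlowMeasure.tendsto_integral {ν : Measure (Boundary k × Boundary k)}
    (hν : IsFlowMeasure ν) (ψ : C(Boundary k × Boundary k, ℝ)) :
    Tendsto (fun n : ℕ => ∫ x, ψ (geodShift^[n] (seed x)) ∂(ν.map Prod.snd)) atTop
      (𝓝 (∫ p, ψ p ∂ν)) := by
  have := hν.finite
  rw [Metric.tendsto_atTop]
  intro ε hε
  obtain ⟨δ, hδ, h⟩ := exists_pos_mul_lt ((ν.map Prod.snd).real Set.univ) hε measureReal_nonneg
  obtain ⟨N, hN⟩ := exists_forall_iterate_geodShift_le ψ hδ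
  refine ⟨N, fun n hn => ?_⟩
  have h1 := abs_integral_iterate_sub_le (hN n hn) hν.conull rfl
  rw [hν.integral_iterate, abs_sub_comm] at h1
  exact h1.trans_lt (h _ (by linarith))

theorem IsFlowMeasure.eq_of_map_snd_eq {ν ν' : Measure (Boundary k × Boundary k)}
    (hν : IsFlowMeasure ν) (hν' : IsFlowMeasure ν') (h : ν.map Prod.snd = ν'.map Prod.snd) :
    ν = ν' := by
  have := hν.finite
  have := hν'.finite
  refine ext_of_forall_integral_eq_of_IsFiniteMeasure fun ψ => ?_
  have h1 := hν.tendsto_integral ψ.toContinuousMap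
  rw [h] at h1
  exact tendsto_nhds_unique h1 (hν'.tendsto_integral ψ.toContinuousMap)

theorem exists_tendsto_integral {μ : Measure (Boundary k)} [IsFiniteMeasure μ]
    (hμ : MeasurePreserving (Tmap k) μ μ) (ψ : C(Boundary k × Boundary k, ℝ)) :
    ∃ l, Tendsto (fun n : ℕ => ∫ x, ψ (geodShift^[n] (seed x)) ∂μ) atTop (𝓝 l) := by
  apply cauchySeq_tendsto_of_complete
  rw [Metric.cauchySeq_iff']
  intro ε hε
  obtain ⟨δ, hδ, h⟩ := exists_pos_mul_lt (μ.real Set.univ) hε measureReal_nonneg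
  obtain ⟨N, hN⟩ := exists_forall_iterate_geodShift_le ψ hδ
  refine ⟨N, fun n hn => ?_⟩
  obtain ⟨j, rfl⟩ := Nat.exists_eq_add_of_le hn
  have hmeas := (continuous_iterate_seed (k := k) j).measurable
  have hconull : μ.map (fun x => geodShift^[j] (seed x)) (baseBall k)ᶜ = 0 := by
    rw [Measure.map_apply hmeas measurableSet_baseBall.compl]
    convert measure_empty (μ := μ)
    ext x
    simpa using iterate_geodShift_mem_baseBall j (seed_mem_baseBall x)
  have hsnd : (μ.map (fun x => geodShift^[j] (seed x))).map Prod.snd = μ := by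
    rw [Measure.map_map measurable_snd hmeas]
    convert (hμ.iterate j).map_eq using 2
    funext x
    exact iterate_geodShift_snd j (seed x)
  have hc : Continuous fun p => ψ (geodShift^[N] p) :=
    ψ.continuous.comp (continuous_geodShift.iterate N)
  have h1 := abs_integral_iterate_sub_le (hN N le_rfl) hconull hsnd
  rw [integral_map hmeas.aemeasurable hc.aestronglyMeasurable] at h1
  simp only [← Function.iterate_add_apply] at h1
  exact h1.trans_lt (h _ (by linarith))

theorem exists_measure_tendsto_integral {μ : Measure (Boundary k)} [IsFiniteMeasure μ]
    (hμ : MeasurePreserving (Tmap k) μ μ) :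
    ∃ ν : Measure (Boundary k × Boundary k), IsFiniteMeasure ν ∧
      ∀ ψ : C(Boundary k × Boundary k, ℝ),
        Tendsto (fun n : ℕ => ∫ x, ψ (geodShift^[n] (seed x)) ∂μ) atTop (𝓝 (∫ p, ψ p ∂ν)) := by
  choose l hl using exists_tendsto_integral hμ
  have hint : ∀ (ψ : C(Boundary k × Boundary k, ℝ)) (n : ℕ),
      Integrable (fun x => ψ (geodShift^[n] (seed x))) μ := fun ψ n =>
    integrable_of_continuous (ψ.continuous.comp (continuous_iterate_seed n))
  let Λ : CompactlySupportedContinuousMap (Boundary k × Boundary k) ℝ →ₚ[ℝ] ℝ :=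
    { toFun := fun f => l f.toContinuousMap
      map_add' := fun f g => by
        refine tendsto_nhds_unique (hl _) ?_
        refine ((hl f.toContinuousMap).add (hl g.toContinuousMap)).congr fun n => ?_
        exact (integral_add (hint f.toContinuousMap n) (hint g.toContinuousMap n)).symm
      map_smul' := fun c f => by
        refine tendsto_nhds_unique (hl _) ?_
        refine ((hl f.toContinuousMap).const_smul c).congr fun n => ?_
        exact (integral_smul c _).symm
      monotone' := fun f g hfg => by
        refine le_of_tendsto_of_tendsto' (hl f.toContinuousMap) (hl g.toContinuousMap) fun n => ?_
        exact integral_mono (hint f.toContinuousMap n) (hint g.toContinuousMap n)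
          fun x => hfg _ }
  refine ⟨RealRMK.rieszMeasure Λ, inferInstance, fun ψ => ?_⟩
  let ψ' : CompactlySupportedContinuousMap (Boundary k × Boundary k) ℝ :=
    { toContinuousMap := ψ
      hasCompactSupport' := HasCompactSupport.of_compactSpace _ }
  have h : ∫ p, ψ p ∂(RealRMK.rieszMeasure Λ) = l ψ := RealRMK.integral_rieszMeasure Λ ψ'
  rw [h]
  exact hl ψ

/-- Every frequency measure is the second marginal of a flow measure. -/
theorem exists_isFlowMeasure_map_snd_eq {μ : Measure (Boundary k)} [IsFiniteMeasure μ]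
    (hμ : MeasurePreserving (Tmap k) μ μ) :
    ∃ ν : Measure (Boundary k × Boundary k), IsFlowMeasure ν ∧ ν.map Prod.snd = μ := by
  obtain ⟨ν, hfin, hν⟩ := exists_measure_tendsto_integral hμ
  refine ⟨ν, ⟨hfin, ?_, continuous_geodShift.measurable, ?_⟩, ?_⟩
  · have hcl : IsClopen (baseBall k)ᶜ := isClopen_baseBall.compl
    let ψ : C(Boundary k × Boundary k, ℝ) :=
      ⟨(baseBall k)ᶜ.indicator fun _ => 1, continuous_indicator hcl continuous_const⟩
    have h1 : ∫ p, ψ p ∂ν = ν.real (baseBall k)ᶜ :=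
      integral_indicator_one hcl.isOpen.measurableSet
    have h2 : ∀ n, ∫ x, ψ (geodShift^[n] (seed x)) ∂μ = 0 := fun n => by
      have : ∀ x, ψ (geodShift^[n] (seed x)) = 0 := fun x =>
        Set.indicator_of_notMem (s := (baseBall k)ᶜ)
          (fun h => h (iterate_geodShift_mem_baseBall n (seed_mem_baseBall x))) fun _ => 1
      simp [this]
    have h3 := hν ψ
    simp only [h2, h1] at h3
    have h4 := tendsto_nhds_unique tendsto_const_nhds h3
    exact (measureReal_eq_zero_iff).1 h4.symm
  · have := Measure.isFiniteMeasure_map ν (geodShift (k := k))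
    refine ext_of_forall_integral_eq_of_IsFiniteMeasure fun ψ => ?_
    rw [integral_map continuous_geodShift.measurable.aemeasurable
      ψ.continuous.aestronglyMeasurable]
    refine tendsto_nhds_unique
      (hν (ψ.toContinuousMap.comp ⟨geodShift, continuous_geodShift⟩)) ?_
    refine ((tendsto_add_atTop_iff_nat 1).2 (hν ψ.toContinuousMap)).congr fun n => ?_
    simp only [Function.iterate_succ_apply']
    rfl
  · have := Measure.isFiniteMeasure_map ν (Prod.snd : Boundary k × Boundary k → Boundary k)
    refine ext_of_forall_integral_eq_of_IsFiniteMeasure fun φ => ?_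
    rw [integral_map measurable_snd.aemeasurable φ.continuous.aestronglyMeasurable]
    refine tendsto_nhds_unique (hν (φ.toContinuousMap.comp ⟨Prod.snd, continuous_snd⟩)) ?_
    refine tendsto_const_nhds.congr fun n => ?_
    have hT := hμ.iterate n
    have h1 : ∀ x, (φ.toContinuousMap.comp ⟨Prod.snd, continuous_snd⟩)
        (geodShift^[n] (seed x)) = φ ((Tmap k)^[n] x) := fun x => by
      simp [iterate_geodShift_snd, seed]
    simp only [h1]
    conv_lhs => rw [← hT.map_eq]
    rw [integral_map hT.measurable.aemeasurable φ.continuous.aestronglyMeasurable]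

end Extension

section Restriction

theorem IsCurrent.measure_compl_D2 {η : Measure (Boundary k × Boundary k)} (hη : IsCurrent k η) :
    η (D2 k)ᶜ = 0 := by
  convert hη.1 using 2
  ext p
  simp [D2]

theorem IsCurrent.isFiniteMeasure_restrict {η : Measure (Boundary k × Boundary k)}
    (hη : IsCurrent k η) : IsFiniteMeasure (η.restrict (baseBall k)) :=
  MeasureTheory.isFiniteMeasure_restrict.2
    (hη.2.2 _ baseBall_subset_D2 isClopen_baseBall.isClosed.isCompact).ne

theorem IsCurrent.measure_preimage_geodShift {η : Measure (Boundary k × Boundary k)}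
    (hη : IsCurrent k η) {W : Set (Boundary k × Boundary k)} (hW : MeasurableSet W) :
    η (geodShift ⁻¹' W ∩ baseBall k) = η (W ∩ baseBall k) := by
  have hm1 : Measurable fun p : Boundary k × Boundary k => p.2.1 0 :=
    ((continuous_coord 0).comp continuous_snd).measurable
  have hm2 : Measurable fun p : Boundary k × Boundary k => linv k (p.1.1 0) :=
    ((continuous_of_discreteTopology (f := linv k)).comp
      ((continuous_coord 0).comp continuous_fst)).measurable
  have hsum : ∀ (f : Boundary k × Boundary k → L k), Measurable f →
      ∀ V : Set (Boundary k × Boundary k), η V = ∑ a : L k, η (f ⁻¹' {a} ∩ V) := by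
    intro f hf V
    have h := sum_measure_preimage_singleton (μ := η.restrict V) (f := f) Finset.univ
      fun a _ => hf (measurableSet_singleton a)
    simp only [Finset.coe_univ, Set.preimage_univ, Measure.restrict_apply_univ] at h
    rw [← h]
    exact Finset.sum_congr rfl fun a _ => Measure.restrict_apply (hf (measurableSet_singleton a))
  rw [hsum _ hm1, hsum _ hm2 (W ∩ _)]
  refine Finset.sum_congr rfl fun a _ => ?_
  rw [← hη.2.1 (el k (linv k a)) _
    ((hm2 (measurableSet_singleton a)).inter (hW.inter measurableSet_baseBall))]
  congr 1
  ext p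
  simp only [Set.mem_inter_iff, Set.mem_preimage, Set.mem_singleton_iff]
  constructor
  · rintro ⟨h, hp, hpB⟩
    have h1 : actPair k (el k (linv k a)) p = geodShift p := by rw [geodShift, h]
    rw [h1]
    refine ⟨?_, hp, geodShift_mem_baseBall hpB⟩
    rw [geodShift_fst hpB, cons, h, linv_linv]
  · rintro ⟨h, hp, hpB⟩
    have h0 : (letterAct (linv k a) p.1).1 0 = linv k a := by
      rw [← act_el]
      exact (linv_linv _).symm.trans (congrArg (linv k) h)
    have h2 : p.2.1 0 = a := by
      by_contra h2
      refine mem_baseBall.1 hpB ?_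
      simp only [actPair, act_el]
      rw [h0, letterAct_zero_of_ne (by rwa [linv_linv])]
    have h1 : actPair k (el k (linv k a)) p = geodShift p := by rw [geodShift, h2]
    refine ⟨h2, h1 ▸ hp, mem_baseBall.2 fun h3 => ?_⟩
    exact letterAct_zero_ne (a := linv k a) (by rw [h3, h2, linv_linv]) h0

theorem IsCurrent.isFlowMeasure_restrict {η : Measure (Boundary k × Boundary k)}
    (hη : IsCurrent k η) : IsFlowMeasure (η.restrict (baseBall k)) := by
  refine ⟨hη.isFiniteMeasure_restrict, ?_, continuous_geodShift.measurable, ?_⟩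
  · rw [Measure.restrict_apply measurableSet_baseBall.compl, Set.compl_inter_self, measure_empty]
  · ext W hW
    rw [Measure.map_apply continuous_geodShift.measurable hW, Measure.restrict_apply hW,
      Measure.restrict_apply (continuous_geodShift.measurable hW),
      hη.measure_preimage_geodShift hW]

theorem IsFlowMeasure.restrict_currentOf {ν : Measure (Boundary k × Boundary k)}
    (hν : IsFlowMeasure ν) : (currentOf ν).restrict (baseBall k) = ν := by
  ext W hW
  have h1 : W ∩ baseBall k ⊆ ball 1 := fun p hp => by
    simpa [ball, actPair_one] using hp.2
  have h2 : actPair k 1 ⁻¹' (W ∩ baseBall k) = W ∩ baseBall k := by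
    ext p
    simp [actPair_one]
  rw [Measure.restrict_apply hW,
    hν.currentOf_apply_of_subset_ball (hW.inter measurableSet_baseBall) h1, h2,
    measure_inter_conull hν.conull]

/-- A current is determined by its restriction to the base-ball. -/
theorem IsCurrent.eq_of_restrict_eq {η η' : Measure (Boundary k × Boundary k)}
    (hη : IsCurrent k η) (hη' : IsCurrent k η')
    (h : η.restrict (baseBall k) = η'.restrict (baseBall k)) : η = η' := by
  ext W hW
  rw [measure_eq_tsum_pieces hη.measure_compl_D2 hW,
    measure_eq_tsum_pieces hη'.measure_compl_D2 hW]
  congr 1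
  funext n
  have hm : MeasurableSet (piece k n ∩ W) := (measurableSet_piece n).inter hW
  have hsub : actPair k (enumF k n) ⁻¹' (piece k n ∩ W) ⊆ baseBall k :=
    subset_ball_iff.1 (Set.inter_subset_left.trans (piece_subset n))
  rw [← hη.2.1 (enumF k n) _ hm, ← hη'.2.1 (enumF k n) _ hm,
    ← Measure.restrict_eq_self η hsub, h, Measure.restrict_eq_self η' hsub]

end Restriction

section Correspondence

theorem FreqM.measurePreserving (μ : FreqM k) : MeasurePreserving (Tmap k) μ.1 μ.1 := by
  refine ⟨continuous_Tmap.measurable, ?_⟩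
  ext W hW
  rw [Measure.map_apply continuous_Tmap.measurable hW, μ.2.2 W hW]

theorem FreqM.exists_flow (μ : FreqM k) : ∃ ν : Measure (Boundary k × Boundary k),
    IsFlowMeasure ν ∧ ν.map Prod.snd = μ.1 :=
  have := μ.2.1
  exists_isFlowMeasure_map_snd_eq μ.measurePreserving

/-- The flow measure with a given frequency measure as second marginal. -/
def flowOf (μ : FreqM k) : Measure (Boundary k × Boundary k) := μ.exists_flow.choose

theorem isFlowMeasure_flowOf (μ : FreqM k) : IsFlowMeasure (flowOf μ) :=
  μ.exists_flow.choose_spec.1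

theorem map_snd_flowOf (μ : FreqM k) : (flowOf μ).map Prod.snd = μ.1 :=
  μ.exists_flow.choose_spec.2

/-- The geodesic current of a frequency measure. -/
def toCurrent (μ : FreqM k) : Currents k :=
  ⟨currentOf (flowOf μ), (isFlowMeasure_flowOf μ).isCurrent_currentOf⟩

theorem IsFlowMeasure.measurePreserving_map_snd {ν : Measure (Boundary k × Boundary k)}
    (hν : IsFlowMeasure ν) :
    MeasurePreserving (Tmap k) (ν.map Prod.snd) (ν.map Prod.snd) := by
  refine ⟨continuous_Tmap.measurable, ?_⟩
  have h : Tmap k ∘ Prod.snd = Prod.snd ∘ geodShift (k := k) :=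
    funext fun p => (geodShift_snd p).symm
  rw [Measure.map_map continuous_Tmap.measurable measurable_snd, h,
    ← Measure.map_map measurable_snd hν.invariant.measurable, hν.invariant.map_eq]

/-- The frequency measure of a geodesic current. -/
def toFreq (η : Currents k) : FreqM k :=
  ⟨(η.1.restrict (baseBall k)).map Prod.snd,
    have := η.2.isFiniteMeasure_restrict
    Measure.isFiniteMeasure_map _ _,
    fun _ hW => η.2.isFlowMeasure_restrict.measurePreserving_map_snd.measure_preimage
      hW.nullMeasurableSet⟩

theorem toFreq_toCurrent (μ : FreqM k) : toFreq (toCurrent μ) = μ := by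
  refine Subtype.ext ?_
  change ((currentOf (flowOf μ)).restrict (baseBall k)).map Prod.snd = μ.1
  rw [(isFlowMeasure_flowOf μ).restrict_currentOf, map_snd_flowOf]

theorem toFreq_injective : Function.Injective (toFreq (k := k)) := fun η η' h =>
  Subtype.ext (η.2.eq_of_restrict_eq η'.2
    (η.2.isFlowMeasure_restrict.eq_of_map_snd_eq η'.2.isFlowMeasure_restrict
      (congrArg Subtype.val h)))

theorem toCurrent_toFreq (η : Currents k) : toCurrent (toFreq η) = η :=
  toFreq_injective (toFreq_toCurrent _)

theorem measurableSet_Cyl (v : F k) : MeasurableSet (Cyl k v) := by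
  have : Cyl k v = ⋂ i : Fin v.toWord.length, { x | x.1 i = v.toWord.get i } := by
    ext x
    simp [Cyl]
  rw [this]
  exact MeasurableSet.iInter fun i =>
    (continuous_coord i).measurable (measurableSet_singleton (v.toWord.get i))

theorem baseCyl_eq (w : F k) : baseCyl k w = Prod.snd ⁻¹' Cyl k w ∩ baseBall k := by
  ext p
  simp only [Set.mem_inter_iff, mem_baseBall]
  exact and_comm

theorem toFreq_Cyl (η : Currents k) (x y : F k) :
    (toFreq η).1 (Cyl k (x⁻¹ * y)) = η.1 (Cyl2 k x y) := by
  have hm : MeasurableSet (Prod.snd ⁻¹' Cyl k (x⁻¹ * y) : Set (Boundary k × Boundary k)) :=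
    measurable_snd (measurableSet_Cyl (x⁻¹ * y))
  rw [Cyl2, Set.image_eq_preimage_of_inverse (g := actPair k x⁻¹) (actPair_inv_actPair x)
    (actPair_actPair_inv x), baseCyl_eq, η.2.2.1 _ _ (hm.inter measurableSet_baseBall),
    ← Measure.restrict_apply hm]
  exact Measure.map_apply measurable_snd (measurableSet_Cyl _)

theorem toFreq_univ (η : Currents k) : (toFreq η).1 Set.univ = η.1 (baseBall k) := by
  refine (Measure.map_apply measurable_snd MeasurableSet.univ).trans ?_
  rw [Set.preimage_univ, Measure.restrict_apply_univ]

end Correspondence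

section Continuity

theorem continuous_integral_freq (φ : C(Boundary k, ℝ)) :
    Continuous fun μ : FreqM k => ∫ x, φ x ∂μ.1 :=
  continuous_iInf_dom (i := φ) continuous_induced_dom

theorem continuous_integral_current (φ : TestF k) :
    Continuous fun η : Currents k => ∫ p, φ.1 p ∂η.1 :=
  continuous_iInf_dom (i := φ) continuous_induced_dom

theorem continuous_toFreq : Continuous (toFreq (k := k)) := by
  refine continuous_iInf_rng.2 fun φ => continuous_induced_rng.2 ?_
  have hsupp : tsupport ((baseBall k).indicator fun p => φ p.2) ⊆ baseBall k :=
    closure_minimal Set.support_indicator_subset isClopen_baseBall.isClosed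
  let ψ : TestF k := ⟨(baseBall k).indicator fun p => φ p.2,
    continuous_indicator isClopen_baseBall (φ.continuous.comp continuous_snd),
    (isClosed_tsupport _).isCompact, hsupp.trans baseBall_subset_D2⟩
  refine (continuous_integral_current ψ).congr fun η => ?_
  change ∫ p, (baseBall k).indicator (fun p => φ p.2) p ∂η.1 =
    ∫ x, φ x ∂((η.1.restrict (baseBall k)).map Prod.snd)
  rw [integral_indicator measurableSet_baseBall,
    integral_map measurable_snd.aemeasurable φ.continuous.aestronglyMeasurable]

theorem continuous_mass : Continuous fun μ : FreqM k => μ.1.real Set.univ := by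
  refine (continuous_integral_freq (ContinuousMap.const _ 1)).congr fun μ => ?_
  simp

theorem continuous_integral_flowOf (ψ : C(Boundary k × Boundary k, ℝ)) :
    Continuous fun μ : FreqM k => ∫ p, ψ p ∂(flowOf μ) := by
  refine continuous_of_locally_uniform_approx_of_continuousAt fun μ u hu => ?_
  obtain ⟨ε, hε, hεu⟩ := Metric.mem_uniformity_dist.1 hu
  obtain ⟨δ, hδ, h⟩ := exists_pos_mul_lt (μ.1.real Set.univ) hε measureReal_nonneg
  obtain ⟨N, hN⟩ := exists_forall_iterate_geodShift_le ψ hδ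
  refine ⟨{ μ' | μ'.1.real Set.univ < μ.1.real Set.univ + 1 },
    (isOpen_lt continuous_mass continuous_const).mem_nhds (lt_add_one (μ.1.real Set.univ)),
    fun μ' => ∫ x, ψ (geodShift^[N] (seed x)) ∂μ'.1,
    (continuous_integral_freq
      (ψ.comp ⟨fun x => geodShift^[N] (seed x), continuous_iterate_seed N⟩)).continuousAt,
    fun μ' hμ' => hεu ?_⟩
  have hν := isFlowMeasure_flowOf μ'
  have := hν.finite
  have h1 := abs_integral_iterate_sub_le (hN N le_rfl) hν.conull (map_snd_flowOf μ')
  rw [hν.integral_iterate] at h1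
  exact h1.trans_lt (h _ (le_of_lt hμ'))

theorem IsFlowMeasure.restrict_currentOf_piece {ν : Measure (Boundary k × Boundary k)}
    (hν : IsFlowMeasure ν) (n : ℕ) : (currentOf ν).restrict (piece k n) =
      (ν.map (actPair k (enumF k n))).restrict (piece k n) := by
  ext W hW
  have hm := hW.inter (measurableSet_piece n)
  rw [Measure.restrict_apply hW, Measure.restrict_apply hW,
    Measure.map_apply (measurable_actPair _) hm, hν.currentOf_apply_of_subset_ball hm
      (Set.inter_subset_right.trans (piece_subset n))]

theorem IsFlowMeasure.setIntegral_currentOf_piece {ν : Measure (Boundary k × Boundary k)}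
    (hν : IsFlowMeasure ν) (n : ℕ) {φ : Boundary k × Boundary k → ℝ} (hφ : Continuous φ) :
    ∫ p in piece k n, φ p ∂(currentOf ν) =
      ∫ p, (actPair k (enumF k n) ⁻¹' piece k n).indicator (φ ∘ actPair k (enumF k n)) p ∂ν := by
  rw [hν.restrict_currentOf_piece,
    setIntegral_map (measurableSet_piece n) hφ.aestronglyMeasurable
      (measurable_actPair _).aemeasurable,
    integral_indicator (measurable_actPair _ (measurableSet_piece n))]
  rfl

theorem continuous_toCurrent : Continuous (toCurrent (k := k)) := by
  refine continuous_iInf_rng.2 fun φ => continuous_induced_rng.2 ?_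
  obtain ⟨φ, hφ, hK, hKD⟩ := φ
  obtain ⟨t, ht⟩ := exists_subset_biUnion_piece hK hKD
  have hclopen : ∀ n, IsClopen (actPair k (enumF k n) ⁻¹' piece k n) := fun n =>
    (isClopen_piece n).preimage (continuous_actPair _)
  have hc : ∀ n, Continuous ((actPair k (enumF k n) ⁻¹' piece k n).indicator
      (φ ∘ actPair k (enumF k n))) := fun n =>
    continuous_indicator (hclopen n) (hφ.comp (continuous_actPair _))
  refine (continuous_finsetSum t fun n _ => continuous_integral_flowOf ⟨_, hc n⟩).congr fun μ => ?_
  have hν := isFlowMeasure_flowOf μ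
  change ∑ n ∈ t, ∫ p, (actPair k (enumF k n) ⁻¹' piece k n).indicator
    (φ ∘ actPair k (enumF k n)) p ∂(flowOf μ) = ∫ p, φ p ∂(currentOf (flowOf μ))
  rw [← setIntegral_eq_integral_of_forall_compl_eq_zero (s := ⋃ n ∈ t, piece k n)
      fun p hp => image_eq_zero_of_notMem_tsupport fun h => hp (ht h),
    integral_biUnion_finset t (fun n _ => measurableSet_piece n)
      (disjoint_piece.set_pairwise _) fun n _ => ?_]
  · exact Finset.sum_congr rfl fun n _ => (hν.setIntegral_currentOf_piece n hφ).symm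
  · have : IsFiniteMeasure ((currentOf (flowOf μ)).restrict (piece k n)) :=
      MeasureTheory.isFiniteMeasure_restrict.2 (hν.currentOf_piece_lt_top n).ne
    exact integrable_of_continuous hφ

/-- The homeomorphism between frequency measures and geodesic currents. -/
def freqHomeo : FreqM k ≃ₜ Currents k where
  toFun := toCurrent
  invFun := toFreq
  left_inv := toFreq_toCurrent
  right_inv := toCurrent_toFreq
  continuous_toFun := continuous_toCurrent
  continuous_invFun := continuous_toFreq

end Continuity

section Cylinders

/-- The rays sharing their first `n` letters with `x`. -/
def agree (n : ℕ) (x : Boundary k) : Set (Boundary k) := { y | ∀ i < n, y.1 i = x.1 i }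

theorem toWord_prefixEl (x : Boundary k) (n : ℕ) :
    (prefixEl k x n).toWord = List.ofFn fun i : Fin n => x.1 i := by
  have h : FreeGroup.IsReduced (List.ofFn fun i : Fin n => x.1 i) := by
    refine List.isChain_ofFn.2 fun i hi h1 => ?_
    by_contra h2
    refine x.2 i (Prod.ext h1.symm ?_)
    simp only [linv]
    revert h2
    cases (x.1 i).2 <;> cases (x.1 (i + 1)).2 <;> simp
  rw [prefixEl, FreeGroup.toWord_mk, h.reduce_eq]

theorem Cyl_prefixEl (x : Boundary k) (n : ℕ) : Cyl k (prefixEl k x n) = agree n x := by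
  ext y
  have h := toWord_prefixEl x n
  constructor
  · intro hy i hi
    have := hy ⟨i, by rw [h, List.length_ofFn]; exact hi⟩
    simpa [h] using this
  · rintro hy ⟨i, hi⟩
    have hi' : i < n := by simpa [h] using hi
    simpa [h] using hy i hi'

theorem prefixEl_succ_ne_one (x : Boundary k) (n : ℕ) : prefixEl k x (n + 1) ≠ 1 := fun h => by
  have := toWord_prefixEl x (n + 1)
  rw [h, FreeGroup.toWord_one] at this
  simpa using congrArg List.length this

theorem isOpen_agree (n : ℕ) (x : Boundary k) : IsOpen (agree n x) := by
  have : agree n x = ⋂ i : Fin n, { y | y.1 i = x.1 i } := by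
    ext y
    simp [agree, Fin.forall_iff]
  rw [this]
  exact isOpen_iInter_of_finite fun i =>
    (isOpen_discrete {x.1 i}).preimage (continuous_coord (k := k) i)

theorem isClosed_agree (n : ℕ) (x : Boundary k) : IsClosed (agree n x) := by
  have : agree n x = ⋂ i : Fin n, { y | y.1 i = x.1 i } := by
    ext y
    simp [agree, Fin.forall_iff]
  rw [this]
  exact isClosed_iInter fun i => isClosed_eq (continuous_coord (k := k) i) continuous_const

theorem agree_anti (x : Boundary k) : Antitone fun n => agree n x :=
  fun _ _ hmn _ hy i hi => hy i (hi.trans_le hmn)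

theorem exists_agree_subset {x : Boundary k} {U : Set (Boundary k)} (hU : U ∈ 𝓝 x) :
    ∃ n, agree (n + 1) x ⊆ U := by
  have hanti : Antitone fun n => agree (n + 1) x := fun m n hmn => agree_anti x (by omega)
  refine exists_subset_nhds_of_compactSpace hanti.directed_ge (fun n => isClosed_agree _ x)
    fun y hy => ?_
  have : y = x := Subtype.ext (funext fun i =>
    (Set.mem_iInter.1 hy i) i (Nat.lt_succ_self i))
  rwa [this]

theorem agree_eq_of_mem {n : ℕ} {x y : Boundary k} (h : y ∈ agree n x) : agree n y = agree n x := by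
  ext z
  exact forall₂_congr fun i hi => by rw [h i hi]

/-- The nontrivial cylinders. -/
def cylinders (k : ℕ) : Set (Set (Boundary k)) := { s | ∃ n x, agree (n + 1) x = s }

theorem isPiSystem_cylinders : IsPiSystem (cylinders k) := by
  rintro _ ⟨m, x, rfl⟩ _ ⟨n, y, rfl⟩ ⟨z, hzx, hzy⟩
  refine ⟨max m n, z, ?_⟩
  rw [← agree_eq_of_mem hzx, ← agree_eq_of_mem hzy]
  refine subset_antisymm (fun w hw => ⟨fun i hi => hw i (by omega), fun i hi => hw i (by omega)⟩)
    fun w hw i hi => ?_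
  rcases le_total m n with h | h
  · exact hw.2 i (by omega)
  · exact hw.1 i (by omega)

theorem generateFrom_cylinders :
    (inferInstance : MeasurableSpace (Boundary k)) = MeasurableSpace.generateFrom (cylinders k) := by
  have hb : TopologicalSpace.IsTopologicalBasis (cylinders k) := by
    refine TopologicalSpace.isTopologicalBasis_of_isOpen_of_nhds ?_ fun x U hx hU => ?_
    · rintro _ ⟨n, x, rfl⟩
      exact isOpen_agree _ x
    · obtain ⟨n, hn⟩ := exists_agree_subset (hU.mem_nhds hx)
      exact ⟨_, ⟨n, x, rfl⟩, fun _ _ => rfl, hn⟩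
  exact hb.borel_eq_generateFrom

/-- Finite measures on `∂F` are determined by the nontrivial cylinders. -/
theorem ext_of_Cyl {μ μ' : Measure (Boundary k)} [IsFiniteMeasure μ]
    (h : ∀ w : F k, w ≠ 1 → μ (Cyl k w) = μ' (Cyl k w)) : μ = μ' := by
  have hagree : ∀ n x, μ (agree (n + 1) x) = μ' (agree (n + 1) x) := fun n x => by
    rw [← Cyl_prefixEl]
    exact h _ (prefixEl_succ_ne_one x n)
  have hcount : (Set.range fun x : Boundary k => agree 1 x).Countable := by
    have : (Set.range fun x : Boundary k => agree 1 x) ⊆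
        Set.range fun a : L k => { y : Boundary k | y.1 0 = a } := by
      rintro _ ⟨x, rfl⟩
      exact ⟨x.1 0, by ext y; simp [agree]⟩
    exact (Set.countable_range _).mono this
  refine Measure.ext_of_generateFrom_of_cover_subset generateFrom_cylinders
    isPiSystem_cylinders (T := Set.range fun x : Boundary k => agree 1 x) ?_ hcount
    ?_ (fun s _ => measure_ne_top μ s) ?_
  · rintro _ ⟨x, rfl⟩
    exact ⟨0, x, rfl⟩
  · exact Set.eq_univ_of_forall fun x => ⟨_, ⟨x, rfl⟩, fun _ _ => rfl⟩
  · rintro _ ⟨n, x, rfl⟩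
    exact hagree n x

end Cylinders

theorem freq_current_correspondence (k : ℕ) (hk : 2 ≤ k) :
    ∃ α : FreqM k ≃ₜ Currents k,
      (∀ μ : FreqM k, ∀ x y : F k, x ≠ y →
          (α μ).1 (Cyl2 k x y) = μ.1 (Cyl k (x⁻¹ * y))) ∧
      (∀ μ : FreqM k, (α μ).1 (baseBall k) = μ.1 Set.univ) ∧
      ∀ α' : FreqM k ≃ₜ Currents k,
        (∀ μ : FreqM k, ∀ x y : F k, x ≠ y →
            (α' μ).1 (Cyl2 k x y) = μ.1 (Cyl k (x⁻¹ * y))) → α' = α := by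
  refine ⟨freqHomeo, fun μ x y _ => ?_, fun μ => ?_, fun α' h => Homeomorph.ext fun μ => ?_⟩
  · exact (toFreq_Cyl (toCurrent μ) x y).symm.trans (by rw [toFreq_toCurrent])
  · exact (toFreq_univ (toCurrent μ)).symm.trans (by rw [toFreq_toCurrent])
  · refine toFreq_injective ((Subtype.ext ?_).trans (toFreq_toCurrent μ).symm)
    have := (toFreq (α' μ)).2.1
    refine ext_of_Cyl fun w hw => ?_
    have h1 := h μ 1 w hw.symm
    rw [← toFreq_Cyl] at h1
    simpa using h1

end

end FGC
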